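/- arXiv:2407.07290 — 6 statements merged into one kernel-verified Lean document; each statement's English description precedes it below -/
import Mathlib

section
/- Let k be a positive natural number and let p, p' : Fin k → ℝ be probability mass functions with p(h) > 0 and p'(h) > 0 for all h, and suppose p ≠ p'. Then for every α ∈ (0,1], the α-relative Pearson divergence satisfies PE_α > 0. -/
/-- If p ≠ p', then for every α ∈ (0,1] the α-relative Pearson
divergence `PE_α = (1/2)·Σ_h p(h)²/q_α(h) - 1/2` is strictly positive. -/
theorem stmt_4 (k : ℕ) (hk : 0 < k) (p p' : Fin k → ℝ)
    (hp : ∀ h, 0 < p h) (hp1 : ∑ h, p h = 1)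
    (hp' : ∀ h, 0 < p' h) (hp'1 : ∑ h, p' h = 1)
    (hne : p ≠ p')
    (α : ℝ) (hα : α ∈ Set.Ioc (0 : ℝ) 1) :
    0 < (1/2) * (∑ h, (p h)^2 / ((1 - α) * p h + α * p' h)) - 1/2 := by
  obtain ⟨h0, h1⟩ := hα
  have hq : ∀ h, 0 < (1 - α) * p h + α * p' h := fun h => by
    have h2 := mul_nonneg (sub_nonneg.2 h1) (hp h).le
    have h3 := mul_pos h0 (hp' h)
    linarith
  have key : ∀ h, (p h)^2 / ((1 - α) * p h + α * p' h)
      = (2 * p h - ((1 - α) * p h + α * p' h))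
        + (α * (p h - p' h))^2 / ((1 - α) * p h + α * p' h) := fun h => by
    have hne0 := (hq h).ne'
    rw [eq_comm, ← sub_eq_zero, add_sub_assoc, ← sub_div, add_div' _ _ _ hne0,
      div_eq_zero_iff]
    left
    ring
  have hs : ∑ h, (2 * p h - ((1 - α) * p h + α * p' h)) = 1 := by
    rw [Finset.sum_sub_distrib, Finset.sum_add_distrib, ← Finset.mul_sum, ← Finset.mul_sum,
      ← Finset.mul_sum, hp1, hp'1]
    ring
  have hpos : 0 < ∑ h, (α * (p h - p' h))^2 / ((1 - α) * p h + α * p' h) := by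
    obtain ⟨i, hi⟩ := Function.ne_iff.1 hne
    refine Finset.sum_pos' (fun h _ => div_nonneg (sq_nonneg _) (hq h).le)
      ⟨i, Finset.mem_univ i, div_pos ?_ (hq i)⟩
    have := mul_ne_zero h0.ne' (sub_ne_zero.2 hi)
    positivity
  rw [Finset.sum_congr rfl (fun h _ => key h), Finset.sum_add_distrib, hs]
  linarith
end

section
/- Let k be a positive natural number and let p, p' : Fin k → ℝ be probability mass functions with p(h) > 0 and p'(h) > 0 for all h. For every α ∈ (0,1], the α-relative Pearson divergence PE_α equals 0 if and only if p = p'. -/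
/-- For every α ∈ (0,1], the α-relative Pearson divergence
`PE_α = (1/2)·Σ_h p(h)²/q_α(h) - 1/2` equals 0 iff p = p'. -/
theorem stmt_5 (k : ℕ) (hk : 0 < k) (p p' : Fin k → ℝ)
    (hp : ∀ h, 0 < p h) (hp1 : ∑ h, p h = 1)
    (hp' : ∀ h, 0 < p' h) (hp'1 : ∑ h, p' h = 1)
    (α : ℝ) (hα : α ∈ Set.Ioc (0 : ℝ) 1) :
    (1/2) * (∑ h, (p h)^2 / ((1 - α) * p h + α * p' h)) - 1/2 = 0 ↔ p = p' := by
  obtain ⟨h0, h1⟩ := hα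
  have hq : ∀ h, 0 < (1 - α) * p h + α * p' h := fun h =>
    add_pos_of_nonneg_of_pos (mul_nonneg (by linarith) (hp h).le) (mul_pos h0 (hp' h))
  have key : ∑ h, (α * (p h - p' h))^2 / ((1 - α) * p h + α * p' h)
      = ∑ h, (p h)^2 / ((1 - α) * p h + α * p' h) - 1 := by
    have e : ∀ h, (α * (p h - p' h))^2 / ((1 - α) * p h + α * p' h)
        = (p h)^2 / ((1 - α) * p h + α * p' h) - 2 * p h + ((1 - α) * p h + α * p' h) := by
      intro h
      have := (hq h).ne'
      rw [div_eq_iff this, add_mul, sub_mul, div_mul_cancel₀ _ this]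
      ring
    simp only [e, Finset.sum_add_distrib, Finset.sum_sub_distrib, ← Finset.mul_sum, hp1, hp'1]
    ring
  constructor
  · intro H
    have z : ∑ h, (α * (p h - p' h))^2 / ((1 - α) * p h + α * p' h) = 0 := by
      rw [key]; linarith
    rw [Finset.sum_eq_zero_iff_of_nonneg
      (fun h _ => div_nonneg (sq_nonneg _) (hq h).le)] at z
    funext h
    have := z h (Finset.mem_univ h)
    rw [div_eq_zero_iff, or_iff_left (hq h).ne', sq_eq_zero_iff, mul_eq_zero,
      or_iff_right h0.ne'] at this
    linarith
  · rintro rfl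
    simp only [sub_self, mul_zero, ne_eq, OfNat.ofNat_ne_zero, not_false_eq_true, zero_pow,
      zero_div, Finset.sum_const_zero] at key
    linarith
end

section
/- Let k be a positive natural number and let p, p' : Fin k → ℝ be probability mass functions with p(h) > 0 and p'(h) > 0 for all h, and suppose p ≠ p'. Then for every α ∈ [0,1], the second derivative of f(α) = Σ_h p(h)²/((1-α)·p(h) + α·p'(h)) at α is strictly positive; explicitly f''(α) = Σ_h 2·p(h)·(p'(h)/p(h) - 1)² / (1 + (p'(h)/p(h) - 1)·α)³ > 0. -/
/-- If p ≠ p', then for every α ∈ [0,1] the second derivative of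
`f(α) = Σ_h p(h)²/((1-α)·p(h) + α·p'(h))` at α is strictly positive, and equals
`Σ_h 2·p(h)·(p'(h)/p(h) - 1)² / (1 + (p'(h)/p(h) - 1)·α)³`. -/
theorem stmt_8 (k : ℕ) (hk : 0 < k) (p p' : Fin k → ℝ)
    (hp : ∀ h, 0 < p h) (hp1 : ∑ h, p h = 1)
    (hp' : ∀ h, 0 < p' h) (hp'1 : ∑ h, p' h = 1)
    (hne : p ≠ p')
    (α : ℝ) (hα : α ∈ Set.Icc (0 : ℝ) 1) :
    deriv (deriv (fun β : ℝ => ∑ h, (p h)^2 / ((1 - β) * p h + β * p' h))) α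
      = (∑ h, 2 * p h * (p' h / p h - 1)^2 / (1 + (p' h / p h - 1) * α)^3) ∧
    0 < ∑ h, 2 * p h * (p' h / p h - 1)^2 / (1 + (p' h / p h - 1) * α)^3 := by
  have hD : ∀ h, 0 < (1 - α) * p h + α * p' h := by
    intro h
    obtain ⟨h0, h1⟩ := hα
    rcases h0.eq_or_lt with h0 | h0
    · rw [← h0]; simpa using hp h
    · have := mul_pos h0 (hp' h)
      have := mul_nonneg (sub_nonneg.2 h1) (hp h).le
      linarith
  have hE : ∀ h, 1 + (p' h / p h - 1) * α = ((1 - α) * p h + α * p' h) / p h := by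
    intro h
    have := (hp h).ne'
    field_simp
    ring
  have hlin : ∀ h (β : ℝ), HasDerivAt (fun β : ℝ => (1 - β) * p h + β * p' h) (p' h - p h) β := by
    intro h β
    have h1 := (((hasDerivAt_id β).const_sub 1).mul_const (p h)).add
      ((hasDerivAt_id β).mul_const (p' h))
    refine h1.congr_deriv ?_
    ring
  have hev : ∀ᶠ β in nhds α, ∀ h, 0 < (1 - β) * p h + β * p' h := by
    rw [Filter.eventually_all]
    intro h
    exact (hlin h α).continuousAt.eventually (lt_mem_nhds (hD h))
  have hd : deriv (fun β : ℝ => ∑ h, (p h)^2 / ((1 - β) * p h + β * p' h)) =ᶠ[nhds α]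
      fun β => ∑ h, (-((p h)^2 * (p' h - p h))) / ((1 - β) * p h + β * p' h)^2 := by
    filter_upwards [hev] with β hβ
    refine HasDerivAt.deriv ?_
    refine HasDerivAt.fun_sum fun h _ => ?_
    refine ((hasDerivAt_const β ((p h)^2)).div (hlin h β) (hβ h).ne').congr_deriv ?_
    ring
  refine ⟨?_, ?_⟩
  · rw [hd.deriv_eq]
    refine HasDerivAt.deriv ?_
    refine HasDerivAt.fun_sum fun h _ => ?_
    refine ((hasDerivAt_const α (-((p h)^2 * (p' h - p h)))).div ((hlin h α).pow 2)
      (pow_pos (hD h) 2).ne').congr_deriv ?_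
    rw [hE]
    have h1 := (hp h).ne'
    have h2 := (hD h).ne'
    simp only [Pi.pow_apply]
    generalize (1 - α) * p h + α * p' h = D at *
    field_simp
    ring
  · obtain ⟨h, hh⟩ := Function.ne_iff.1 hne
    have hpos : ∀ h, 0 < 1 + (p' h / p h - 1) * α := fun h => by
      rw [hE]; exact div_pos (hD h) (hp h)
    refine Finset.sum_pos' (fun i _ => ?_) ⟨h, Finset.mem_univ h, ?_⟩
    · have := hpos i
      have := hp i
      exact div_nonneg (by positivity) (by positivity)
    · have := hpos h
      have := hp h
      have h3 : p' h / p h - 1 ≠ 0 := by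
        intro h4
        rw [sub_eq_zero, div_eq_one_iff_eq this.ne'] at h4
        exact hh h4.symm
      exact div_pos (by positivity) (by positivity)
end

section
/- Let k be a positive natural number and let p, p' : Fin k → ℝ be probability mass functions with p(h) > 0 and p'(h) > 0 for all h. The function f(α) = Σ_h p(h)²/((1-α)·p(h) + α·p'(h)) is monotone nondecreasing on [0,1]; consequently PE_α = (1/2)·f(α) - 1/2 is monotone nondecreasing in α on [0,1]. -/
/-- `f(α) = Σ_h p(h)²/((1-α)·p(h) + α·p'(h))` is monotone
nondecreasing on [0,1]; consequently `PE_α = (1/2)·f(α) - 1/2` is monotone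
nondecreasing in α on [0,1]. -/
theorem stmt_9 (k : ℕ) (hk : 0 < k) (p p' : Fin k → ℝ)
    (hp : ∀ h, 0 < p h) (hp1 : ∑ h, p h = 1)
    (hp' : ∀ h, 0 < p' h) (hp'1 : ∑ h, p' h = 1) :
    MonotoneOn (fun α : ℝ => ∑ h, (p h)^2 / ((1 - α) * p h + α * p' h))
        (Set.Icc (0 : ℝ) 1) ∧
    MonotoneOn (fun α : ℝ =>
        (1/2) * (∑ h, (p h)^2 / ((1 - α) * p h + α * p' h)) - 1/2)
        (Set.Icc (0 : ℝ) 1) := by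
  have key : MonotoneOn (fun α : ℝ => ∑ h, (p h)^2 / ((1 - α) * p h + α * p' h))
        (Set.Icc (0 : ℝ) 1) := by
    intro a ha b hb hab
    have hq : ∀ α ∈ Set.Icc (0:ℝ) 1, ∀ h, 0 < (1 - α) * p h + α * p' h := by
      intro α hα h
      obtain ⟨h0, h1⟩ := hα
      rcases h0.eq_or_lt with h2 | h2
      · subst h2
        simpa using hp h
      · have := mul_pos h2 (hp' h)
        have := mul_nonneg (sub_nonneg.2 h1) (hp h).le
        linarith
    have hterm : ∀ h, (p h)^2 / ((1 - a) * p h + a * p' h) + (b - a) * (p h - p' h)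
        ≤ (p h)^2 / ((1 - b) * p h + b * p' h) := by
      intro h
      have hA := hq a ha h
      have hB := hq b hb h
      have e : (p h)^2 / ((1 - b) * p h + b * p' h)
          - ((p h)^2 / ((1 - a) * p h + a * p' h) + (b - a) * (p h - p' h))
          = (b - a) * (p h - p' h)^2 * (a * ((1 - b) * p h + b * p' h) + b * p h)
            / (((1 - a) * p h + a * p' h) * ((1 - b) * p h + b * p' h)) := by
        have hA' := hA.ne'
        have hB' := hB.ne'
        rw [← sub_sub, div_sub_div _ _ hB' hA', sub_eq_iff_eq_add, div_add' _ _ _ (mul_ne_zero hA' hB'),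
          div_eq_div_iff (mul_ne_zero hB' hA') (mul_ne_zero hA' hB')]
        ring
      have h1 := sub_nonneg.2 hab
      have h2 := ha.1
      have h3 := hb.1
      have h4 := hp h
      have : 0 ≤ (b - a) * (p h - p' h)^2 * (a * ((1 - b) * p h + b * p' h) + b * p h)
            / (((1 - a) * p h + a * p' h) * ((1 - b) * p h + b * p' h)) := by
        apply div_nonneg _ (mul_pos hA hB).le
        exact mul_nonneg (mul_nonneg h1 (sq_nonneg _))
          (add_nonneg (mul_nonneg h2 hB.le) (mul_nonneg h3 h4.le))
      linarith
    have hs := Finset.sum_le_sum (fun h (_ : h ∈ Finset.univ) => hterm h)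
    rw [Finset.sum_add_distrib, ← Finset.mul_sum, Finset.sum_sub_distrib, hp1, hp'1] at hs
    simpa using hs
  refine ⟨key, ?_⟩
  intro a ha b hb hab
  have := key ha hb hab
  dsimp only at this ⊢
  linarith
end

section
/- Let k be a positive natural number and let p, p' : Fin k → ℝ be probability mass functions with p(h) > 0 and p'(h) > 0 for all h, and suppose p ≠ p'. Then the function f(α) = Σ_h p(h)²/((1-α)·p(h) + α·p'(h)) is strictly monotone increasing on [0,1]: for all 0 ≤ α₁ < α₂ ≤ 1, f(α₁) < f(α₂). -/
/-- If p ≠ p', then `f(α) = Σ_h p(h)²/((1-α)·p(h) + α·p'(h))` is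
strictly increasing on [0,1]: for all 0 ≤ α₁ < α₂ ≤ 1, f(α₁) < f(α₂). -/
theorem stmt_10 (k : ℕ) (hk : 0 < k) (p p' : Fin k → ℝ)
    (hp : ∀ h, 0 < p h) (hp1 : ∑ h, p h = 1)
    (hp' : ∀ h, 0 < p' h) (hp'1 : ∑ h, p' h = 1)
    (hne : p ≠ p') :
    ∀ α₁ α₂ : ℝ, 0 ≤ α₁ → α₁ < α₂ → α₂ ≤ 1 →
      (∑ h, (p h)^2 / ((1 - α₁) * p h + α₁ * p' h))
        < ∑ h, (p h)^2 / ((1 - α₂) * p h + α₂ * p' h) := by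
  intro a b ha hab hb
  have q1 : ∀ h, 0 < (1 - a) * p h + a * p' h := fun h => by
    have h1 : 0 < (1 - a) * p h := mul_pos (by linarith) (hp h)
    have h2 : 0 ≤ a * p' h := mul_nonneg ha (hp' h).le
    linarith
  have q2 : ∀ h, 0 < (1 - b) * p h + b * p' h := fun h => by
    have h1 : 0 ≤ (1 - b) * p h := mul_nonneg (by linarith) (hp h).le
    have h2 : 0 < b * p' h := mul_pos (by linarith) (hp' h)
    linarith
  have key : ∀ h, (p h)^2 / ((1 - b) * p h + b * p' h) + (b - a) * (p' h - p h)
      - (p h)^2 / ((1 - a) * p h + a * p' h)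
      = (b - a) * (p' h - p h)^2 * ((a * p h + b * ((1 - a) * p h + a * p' h))
        / (((1 - a) * p h + a * p' h) * ((1 - b) * p h + b * p' h))) := fun h => by
    have h1 := (q1 h).ne'
    have h2 := (q2 h).ne'
    rw [div_add' _ _ _ h2, div_sub_div _ _ h2 h1, mul_div_assoc', div_eq_div_iff (mul_ne_zero h2 h1) (mul_ne_zero h1 h2)]
    ring
  have pos : ∀ h, 0 < (a * p h + b * ((1 - a) * p h + a * p' h))
        / (((1 - a) * p h + a * p' h) * ((1 - b) * p h + b * p' h)) := fun h => by
    have h1 : 0 ≤ a * p h := mul_nonneg ha (hp h).le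
    have h2 : 0 < b * ((1 - a) * p h + a * p' h) := mul_pos (by linarith) (q1 h)
    exact div_pos (by linarith) (mul_pos (q1 h) (q2 h))
  have hd : ∑ h, (b - a) * (p' h - p h) = 0 := by
    rw [← Finset.mul_sum, Finset.sum_sub_distrib, hp1, hp'1]; simp
  obtain ⟨j, hj⟩ := Function.ne_iff.mp hne
  have hba : 0 < b - a := by linarith
  have main : 0 < ∑ h, ((p h)^2 / ((1 - b) * p h + b * p' h) + (b - a) * (p' h - p h)
      - (p h)^2 / ((1 - a) * p h + a * p' h)) := by
    apply Finset.sum_pos'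
    · intro h _
      rw [key]
      exact mul_nonneg (mul_nonneg hba.le (sq_nonneg _)) (pos h).le
    · refine ⟨j, Finset.mem_univ _, ?_⟩
      rw [key]
      exact mul_pos (mul_pos hba (sq_pos_iff.mpr (sub_ne_zero.mpr (Ne.symm hj)))) (pos j)
  rw [Finset.sum_sub_distrib, Finset.sum_add_distrib, hd] at main
  linarith
end

section
/- Let k be a positive natural number, let p, p' : Fin k → ℝ be probability mass functions with p(h) > 0 and p'(h) > 0 for all h, and fix α ∈ (0,1]. Then over β ∈ [0,1], the (αβ)-relative Pearson divergence PE_{αβ} = (1/2)·Σ_h p(h)²/((1-αβ)·p(h) + αβ·p'(h)) - 1/2 attains its maximum at β = 1: for every β ∈ [0,1], PE_{αβ} ≤ (1/2)·Σ_h p(h)²/((1-α)·p(h) + α·p'(h)) - 1/2. -/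
theorem aux_conv (a q b : ℝ) (ha : 0 < a) (hq : 0 < q) (hb0 : 0 ≤ b) (hb1 : b ≤ 1)
    (D : ℝ) (hD : D = (1 - b) * a + b * q) (hD0 : 0 < D) :
    a ^ 2 / D ≤ (1 - b) * a + b * (a ^ 2 / q) := by
  have e : (1 - b) * a + b * (a ^ 2 / q) - a ^ 2 / D = a * (b * (1 - b) * (a - q) ^ 2) / (q * D) := by
    field_simp
    rw [hD]
    ring
  have : 0 ≤ a * (b * (1 - b) * (a - q) ^ 2) / (q * D) := by
    have : 0 ≤ 1 - b := by linarith
    positivity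
  linarith

theorem aux_tan (a q : ℝ) (hq : 0 < q) : 2 * a - q ≤ a ^ 2 / q := by
  rw [le_div_iff₀ hq]
  nlinarith [sq_nonneg (a - q)]

/-- For fixed α ∈ (0,1], over β ∈ [0,1] the (αβ)-relative Pearson
divergence `PE_{αβ}` is maximized at β = 1: for every β ∈ [0,1],
`PE_{αβ} ≤ PE_α`. -/
theorem stmt_12 (k : ℕ) (hk : 0 < k) (p p' : Fin k → ℝ)
    (hp : ∀ h, 0 < p h) (hp1 : ∑ h, p h = 1)
    (hp' : ∀ h, 0 < p' h) (hp'1 : ∑ h, p' h = 1)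
    (α : ℝ) (hα : α ∈ Set.Ioc (0 : ℝ) 1) :
    ∀ β ∈ Set.Icc (0 : ℝ) 1,
      (1/2) * (∑ h, (p h)^2 / ((1 - α * β) * p h + α * β * p' h)) - 1/2
        ≤ (1/2) * (∑ h, (p h)^2 / ((1 - α) * p h + α * p' h)) - 1/2 := by
  intro β hβ
  obtain ⟨hα0, hα1⟩ := hα
  obtain ⟨hb0, hb1⟩ := hβ
  have pos : ∀ g : ℝ, 0 ≤ g → g ≤ 1 → ∀ h, 0 < (1 - g) * p h + g * p' h := by
    intro g h0 h1 h
    rcases h0.eq_or_lt with h0 | h0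
    · subst h0
      simpa using hp h
    · have h2 := mul_pos h0 (hp' h)
      have h3 := mul_nonneg (sub_nonneg.2 h1) (hp h).le
      linarith
  have hab : α * β ≤ 1 := by nlinarith
  have h1 : ∑ h, (p h)^2 / ((1 - α * β) * p h + α * β * p' h)
      ≤ ∑ h, ((1 - β) * p h + β * ((p h)^2 / ((1 - α) * p h + α * p' h))) :=
    Finset.sum_le_sum fun h _ => aux_conv _ _ β (hp h) (pos α hα0.le hα1 h) hb0 hb1 _
      (by ring) (pos _ (by positivity) hab h)
  have h2 : ∑ h, (2 * p h - ((1 - α) * p h + α * p' h))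
      ≤ ∑ h, (p h)^2 / ((1 - α) * p h + α * p' h) :=
    Finset.sum_le_sum fun h _ => aux_tan _ _ (pos α hα0.le hα1 h)
  rw [Finset.sum_add_distrib, ← Finset.mul_sum, ← Finset.mul_sum, hp1] at h1
  rw [Finset.sum_sub_distrib, Finset.sum_add_distrib, ← Finset.mul_sum, ← Finset.mul_sum,
    ← Finset.mul_sum, hp1, hp'1] at h2
  nlinarith [mul_nonneg (sub_nonneg.2 hb1) (sub_nonneg.2 h2)]
end
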